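/- arXiv:2512.23478 — 2 statements merged into one kernel-verified Lean document; each statement's English description precedes it below -/
import Mathlib

section
/- Let C ∈ T^reg. Then the Bethe Hamiltonians pairwise commute in t_Φ^trig: for all h₁, h₂ ∈ h one has [BH(C,h₁), BH(C,h₂)] = 0. -/
open FreeLieAlgebra

noncomputable section

/-- The data of a reduced finite root system `Φ` spanning the dual of `H`,
together with a chosen system of positive roots `Φplus`. -/
structure RootSystemData (H : Type) [AddCommGroup H] [Module ℂ H] : Type where
  Φ : Set (Module.Dual ℂ H)
  finite : Φ.Finite
  zero_not_mem : (0 : Module.Dual ℂ H) ∉ Φ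
  spans : Submodule.span ℂ Φ = ⊤
  neg_mem : ∀ α ∈ Φ, -α ∈ Φ
  reduced : ∀ α ∈ Φ, ∀ c : ℂ, c • α ∈ Φ → c = 1 ∨ c = -1
  coroot_exists : ∀ α ∈ Φ, ∃ hα : H, α hα = 2 ∧
      ∀ β ∈ Φ, (β - β hα • α ∈ Φ ∧ ∃ m : ℤ, β hα = (m : ℂ))
  Φplus : Set (Module.Dual ℂ H)
  plus_subset : Φplus ⊆ Φ
  plus_union : Φ = Φplus ∪ {α | -α ∈ Φplus}
  plus_disjoint : Disjoint Φplus {α | -α ∈ Φplus}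
  plus_closed : ∀ α ∈ Φplus, ∀ β ∈ Φplus, α + β ∈ Φ → α + β ∈ Φplus

namespace RootSystemData

variable {H : Type} [AddCommGroup H] [Module ℂ H] (D : RootSystemData H)

open Classical in
/-- The generator `t_α` in the free Lie algebra on `Φ ⊕ h` (junk value `0` for `α ∉ Φ`). -/
def tgen (α : Module.Dual ℂ H) : FreeLieAlgebra ℂ (↥D.Φ ⊕ H) :=
  if h : α ∈ D.Φ then FreeLieAlgebra.of ℂ (Sum.inl (⟨α, h⟩ : ↥D.Φ)) else 0

/-- The generator `τ(h)` in the free Lie algebra on `Φ ⊕ h`. -/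
def ttau (v : H) : FreeLieAlgebra ℂ (↥D.Φ ⊕ H) := FreeLieAlgebra.of ℂ (Sum.inr v)

/-- `δ(h) = τ(h) - (1/2) ∑_{β ∈ Φ⁺} β(h) t_β`. -/
def tdelta (v : H) : FreeLieAlgebra ℂ (↥D.Φ ⊕ H) :=
  D.ttau v - (2⁻¹ : ℂ) • ∑ᶠ β ∈ D.Φplus, β v • D.tgen β

/-- The defining relations of the trigonometric holonomy Lie algebra `t_Φ^trig`:
`t_{-α} = t_α`; `τ` is `ℂ`-linear; `[τ(h₁), τ(h₂)] = 0`; `[t_α, ∑_{β ∈ Ψ⁺} t_β] = 0` for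
every closed rank-2 root subsystem `Ψ ⊆ Φ` and `α ∈ Ψ`; and `[t_α, δ(h)] = 0` whenever
`α(h) = 0`. -/
def trigRel : Set (FreeLieAlgebra ℂ (↥D.Φ ⊕ H)) :=
  {x | (∃ α ∈ D.Φ, x = D.tgen α - D.tgen (-α)) ∨
    (∃ (c₁ c₂ : ℂ) (h₁ h₂ : H),
      x = D.ttau (c₁ • h₁ + c₂ • h₂) - c₁ • D.ttau h₁ - c₂ • D.ttau h₂) ∨
    (∃ h₁ h₂ : H, x = ⁅D.ttau h₁, D.ttau h₂⁆) ∨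
    (∃ Ψ : Set (Module.Dual ℂ H), Ψ ⊆ D.Φ ∧ (∀ α ∈ Ψ, -α ∈ Ψ) ∧
      Module.finrank ℂ (Submodule.span ℂ Ψ) = 2 ∧
      (∀ α ∈ Ψ, ∀ β ∈ Ψ, α + β ∈ D.Φ → α + β ∈ Ψ) ∧
      ∃ α ∈ Ψ, x = ⁅D.tgen α, ∑ᶠ β ∈ Ψ ∩ D.Φplus, D.tgen β⁆) ∨
    (∃ α ∈ D.Φ, ∃ v : H, α v = 0 ∧ x = ⁅D.tgen α, D.tdelta v⁆)}

/-- The Lie ideal generated by the trigonometric relations. -/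
def trigIdeal : LieIdeal ℂ (FreeLieAlgebra ℂ (↥D.Φ ⊕ H)) :=
  LieSubmodule.lieSpan ℂ (FreeLieAlgebra ℂ (↥D.Φ ⊕ H)) D.trigRel

/-- The trigonometric holonomy Lie algebra `t_Φ^trig`. -/
abbrev Trig := FreeLieAlgebra ℂ (↥D.Φ ⊕ H) ⧸ D.trigIdeal

/-- The image of the generator `t_α` in `t_Φ^trig`. -/
def TT (α : Module.Dual ℂ H) : D.Trig := LieSubmodule.Quotient.mk' D.trigIdeal (D.tgen α)

/-- The image of the generator `τ(h)` in `t_Φ^trig`. -/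
def TTau (v : H) : D.Trig := LieSubmodule.Quotient.mk' D.trigIdeal (D.ttau v)

/-- The image of `δ(h)` in `t_Φ^trig`. -/
def TDelta (v : H) : D.Trig := LieSubmodule.Quotient.mk' D.trigIdeal (D.tdelta v)

/-- The root lattice `R = ℤΦ ⊆ h*`. -/
def rootLattice : AddSubgroup (Module.Dual ℂ H) := AddSubgroup.closure D.Φ

/-- The torus `T = Hom_ℤ(R, ℂ^×)`. -/
abbrev Torus := ↥D.rootLattice →+ Additive ℂˣ

open Classical in
/-- The value `e^α(C) ∈ ℂ` of the character `e^α` at `C ∈ T` (junk value `1` for `α ∉ R`). -/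
def toruseval (C : D.Torus) (α : Module.Dual ℂ H) : ℂ :=
  if h : α ∈ D.rootLattice then ((Additive.toMul (C ⟨α, h⟩) : ℂˣ) : ℂ) else 1

/-- `C ∈ T` is regular if `e^α(C) ≠ 1` for all `α ∈ Φ`. -/
def IsRegularTorus (C : D.Torus) : Prop := ∀ α ∈ D.Φ, D.toruseval C α ≠ 1

/-- The Bethe Hamiltonian
`BH(C,h) = τ(h) - ∑_{α ∈ Φ⁺} (e^α(C) α(h)/(e^α(C) - 1)) t_α ∈ t_Φ^trig`. -/
def BH (C : D.Torus) (v : H) : D.Trig :=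
  D.TTau v - ∑ᶠ α ∈ D.Φplus, (D.toruseval C α * α v / (D.toruseval C α - 1)) • D.TT α

/-- The Bethe subspace `Q(C) = span{BH(C,h) : h ∈ h}`. -/
def BetheSubspace (C : D.Torus) : Submodule ℂ D.Trig :=
  Submodule.span ℂ (Set.range (D.BH C))

end RootSystemData

namespace RootSystemData

variable {H : Type} [AddCommGroup H] [Module ℂ H] (D : RootSystemData H)

lemma plus_finite : D.Φplus.Finite := D.finite.subset D.plus_subset

/-- The roots as a finset. -/
def roots : Finset (Module.Dual ℂ H) := D.finite.toFinset

/-- The positive roots as a finset. -/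
def posRoots : Finset (Module.Dual ℂ H) := D.plus_finite.toFinset

variable {D}

@[simp] lemma mem_roots {α : Module.Dual ℂ H} : α ∈ D.roots ↔ α ∈ D.Φ := by simp [roots]

@[simp] lemma mem_posRoots {α : Module.Dual ℂ H} : α ∈ D.posRoots ↔ α ∈ D.Φplus := by
  simp [posRoots]

lemma mem_plus_or_neg_mem {α : Module.Dual ℂ H} (h : α ∈ D.Φ) :
    α ∈ D.Φplus ∨ -α ∈ D.Φplus := by
  rw [D.plus_union] at h
  exact h

lemma neg_notMem_plus {α : Module.Dual ℂ H} (h : α ∈ D.Φplus) : -α ∉ D.Φplus :=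
  fun h' => Set.disjoint_left.1 D.plus_disjoint h h'

lemma ne_zero_of_mem {α : Module.Dual ℂ H} (h : α ∈ D.Φ) : α ≠ 0 := by
  rintro rfl
  exact D.zero_not_mem h

variable (D) in
lemma sum_roots_eq_two_smul {V : Type*} [AddCommGroup V] (Ψ : Set (Module.Dual ℂ H))
    [DecidablePred (· ∈ Ψ)] (hΨ : ∀ α, α ∈ Ψ ↔ -α ∈ Ψ) (y : Module.Dual ℂ H → V)
    (hy : ∀ α ∈ D.Φ, y (-α) = y α) :
    ∑ α ∈ D.roots with α ∈ Ψ, y α = (2 : ℕ) • ∑ α ∈ D.posRoots with α ∈ Ψ, y α := by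
  classical
  have hd : Disjoint (D.posRoots.filter (· ∈ Ψ))
      ((D.posRoots.filter (· ∈ Ψ)).image (fun α => -α)) := by
    rw [Finset.disjoint_left]
    intro α h1 h2
    simp only [Finset.mem_image, Finset.mem_filter, mem_posRoots] at h1 h2
    obtain ⟨β, hβ, rfl⟩ := h2
    exact neg_notMem_plus hβ.1 h1.1
  have hu : D.roots.filter (· ∈ Ψ) = D.posRoots.filter (· ∈ Ψ) ∪
      (D.posRoots.filter (· ∈ Ψ)).image (fun α => -α) := by
    ext α
    simp only [Finset.mem_filter, mem_roots, Finset.mem_union, mem_posRoots, Finset.mem_image]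
    constructor
    · rintro ⟨h1, h2⟩
      rcases mem_plus_or_neg_mem h1 with h | h
      · exact Or.inl ⟨h, h2⟩
      · exact Or.inr ⟨-α, ⟨h, (hΨ α).1 h2⟩, neg_neg α⟩
    · rintro (⟨h1, h2⟩ | ⟨β, ⟨h1, h2⟩, rfl⟩)
      · exact ⟨D.plus_subset h1, h2⟩
      · exact ⟨D.neg_mem _ (D.plus_subset h1), (hΨ β).1 h2⟩
  rw [hu, Finset.sum_union hd, Finset.sum_image neg_injective.injOn, two_smul]
  congr 1
  refine Finset.sum_congr rfl fun α hα => hy α (D.plus_subset ?_)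
  simpa using (Finset.mem_filter.1 hα).1

lemma mk_eq_zero_of_mem_trigRel {x : FreeLieAlgebra ℂ (↥D.Φ ⊕ H)} (hx : x ∈ D.trigRel) :
    LieSubmodule.Quotient.mk' D.trigIdeal x = 0 := by
  exact (LieSubmodule.Quotient.mk_eq_zero' (N := D.trigIdeal)).2 <|
    LieSubmodule.subset_lieSpan hx

lemma mk_lie (x y : FreeLieAlgebra ℂ (↥D.Φ ⊕ H)) :
    LieSubmodule.Quotient.mk' D.trigIdeal ⁅x, y⁆ =
      (⁅LieSubmodule.Quotient.mk' D.trigIdeal x,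
        LieSubmodule.Quotient.mk' D.trigIdeal y⁆ : D.Trig) :=
  LieSubmodule.Quotient.mk_bracket _ x y

lemma TT_neg {α : Module.Dual ℂ H} (h : α ∈ D.Φ) : D.TT (-α) = D.TT α := by
  have := mk_eq_zero_of_mem_trigRel (D := D) (Or.inl ⟨α, h, rfl⟩)
  rw [map_sub, sub_eq_zero] at this
  exact this.symm

lemma TTau_lin (c₁ c₂ : ℂ) (h₁ h₂ : H) :
    D.TTau (c₁ • h₁ + c₂ • h₂) = c₁ • D.TTau h₁ + c₂ • D.TTau h₂ := by
  have := mk_eq_zero_of_mem_trigRel (D := D) (Or.inr (Or.inl ⟨c₁, c₂, h₁, h₂, rfl⟩))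
  rw [map_sub, map_sub, map_smul, map_smul, sub_eq_zero, sub_eq_iff_eq_add] at this
  rw [add_comm (c₁ • D.TTau h₁)]
  exact this

lemma TTau_lie_TTau (h₁ h₂ : H) : ⁅D.TTau h₁, D.TTau h₂⁆ = 0 := by
  have := mk_eq_zero_of_mem_trigRel (D := D) (Or.inr (Or.inr (Or.inl ⟨h₁, h₂, rfl⟩)))
  rwa [mk_lie] at this

lemma TT_lie_sum {Ψ : Set (Module.Dual ℂ H)} [DecidablePred (· ∈ Ψ)] (h1 : Ψ ⊆ D.Φ)
    (h2 : ∀ α ∈ Ψ, -α ∈ Ψ)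
    (h3 : Module.finrank ℂ (Submodule.span ℂ Ψ) = 2)
    (h4 : ∀ α ∈ Ψ, ∀ β ∈ Ψ, α + β ∈ D.Φ → α + β ∈ Ψ) {α : Module.Dual ℂ H} (hα : α ∈ Ψ) :
    ∑ β ∈ D.roots with β ∈ Ψ, ⁅D.TT α, D.TT β⁆ = 0 := by
  have := mk_eq_zero_of_mem_trigRel (D := D)
    (Or.inr (Or.inr (Or.inr (Or.inl ⟨Ψ, h1, h2, h3, h4, α, hα, rfl⟩))))
  have hf : ∑ᶠ β ∈ Ψ ∩ D.Φplus, D.tgen β = ∑ β ∈ D.posRoots with β ∈ Ψ, D.tgen β := by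
    rw [← finsum_mem_coe_finset]
    congr 1
    ext β
    simp [and_comm]
  rw [mk_lie, hf, map_sum, lie_sum] at this
  rw [sum_roots_eq_two_smul D Ψ (fun γ => ⟨h2 γ, fun h => by simpa using h2 _ h⟩)
    (fun β => ⁅D.TT α, D.TT β⁆) (fun β hβ => by rw [TT_neg hβ])]
  erw [this]
  simp

lemma TT_lie_TDelta {α : Module.Dual ℂ H} (hα : α ∈ D.Φ) {v : H} (hv : α v = 0) :
    ⁅D.TT α, D.TTau v⁆ = (2⁻¹ : ℂ) • ∑ β ∈ D.posRoots, β v • ⁅D.TT α, D.TT β⁆ := by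
  have := mk_eq_zero_of_mem_trigRel (D := D)
    (Or.inr (Or.inr (Or.inr (Or.inr ⟨α, hα, v, hv, rfl⟩))))
  have hf : ∑ᶠ β ∈ D.Φplus, β v • D.tgen β = ∑ β ∈ D.posRoots, β v • D.tgen β := by
    rw [← finsum_mem_coe_finset]
    congr 1
    ext β
    simp
  rw [mk_lie, tdelta, hf, map_sub, lie_sub, sub_eq_zero, map_smul, map_sum, lie_smul,
    lie_sum] at this
  refine Eq.trans this ?_
  congr 1
  refine Finset.sum_congr rfl fun β _ => ?_
  rw [map_smul, lie_smul]
  rfl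

/-- A root proportional to `α` is `α` or `-α`. -/
lemma eq_or_eq_neg_of_smul {α β : Module.Dual ℂ H} (hα : α ∈ D.Φ) (hβ : β ∈ D.Φ) {c : ℂ}
    (h : β = c • α) : β = α ∨ β = -α := by
  rcases D.reduced α hα c (h ▸ hβ) with rfl | rfl
  · simp [h]
  · simp [h]

lemma TT_lie_eq_zero_of_smul {α β : Module.Dual ℂ H} (hα : α ∈ D.Φ) (hβ : β ∈ D.Φ) {c : ℂ}
    (h : β = c • α) : ⁅D.TT α, D.TT β⁆ = 0 := by
  rcases eq_or_eq_neg_of_smul hα hβ h with rfl | rfl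
  · exact lie_self _
  · rw [TT_neg hα]; exact lie_self _

open Classical in
/-- The sum over an `α`-string of the commutators with `t_α`. -/
def stringSum (α : Module.Dual ℂ H) (q : Module.Dual ℂ H ⧸ AddSubgroup.zmultiples α) : D.Trig :=
  ∑ γ ∈ D.roots.filter (fun γ : Module.Dual ℂ H =>
    (QuotientAddGroup.mk γ : Module.Dual ℂ H ⧸ AddSubgroup.zmultiples α) = q), ⁅D.TT α, D.TT γ⁆

lemma stringSum_neg (α : Module.Dual ℂ H) (q : Module.Dual ℂ H ⧸ AddSubgroup.zmultiples α) :
    D.stringSum α (-q) = D.stringSum α q := by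
  classical
  refine Finset.sum_nbij' (fun γ => -γ) (fun γ => -γ) ?_ ?_ ?_ ?_ ?_
  · intro γ hγ
    simp only [Finset.mem_filter, mem_roots] at hγ ⊢
    exact ⟨D.neg_mem _ hγ.1, by rw [QuotientAddGroup.mk_neg, hγ.2, neg_neg]⟩
  · intro γ hγ
    simp only [Finset.mem_filter, mem_roots] at hγ ⊢
    exact ⟨D.neg_mem _ hγ.1, by rw [QuotientAddGroup.mk_neg, hγ.2]⟩
  · simp
  · simp
  · intro γ hγ
    simp only [Finset.mem_filter, mem_roots] at hγ
    rw [TT_neg hγ.1]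

/-- The roots in the lattice spanned by `α` and `β`. -/
def latticeRoots (D : RootSystemData H) (α β : Module.Dual ℂ H) : Set (Module.Dual ℂ H) :=
  {γ ∈ D.Φ | ∃ i j : ℤ, γ = i • α + j • β}

lemma finrank_span_latticeRoots {α β : Module.Dual ℂ H} (hα : α ∈ D.Φ) (hβ : β ∈ D.Φ)
    (h : ∀ c : ℂ, β ≠ c • α) :
    Module.finrank ℂ (Submodule.span ℂ (D.latticeRoots α β)) = 2 := by
  have hspan : Submodule.span ℂ (D.latticeRoots α β) =
      Submodule.span ℂ (Set.range ![α, β]) := by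
    apply le_antisymm
    · rw [Submodule.span_le]
      rintro γ ⟨-, i, j, rfl⟩
      refine Submodule.add_mem _ (zsmul_mem ?_ _) (zsmul_mem ?_ _)
      · exact Submodule.subset_span ⟨0, rfl⟩
      · exact Submodule.subset_span ⟨1, rfl⟩
    · rw [Submodule.span_le]
      rintro γ ⟨i, rfl⟩
      apply Submodule.subset_span
      fin_cases i
      · exact ⟨hα, 1, 0, by simp⟩
      · exact ⟨hβ, 0, 1, by simp⟩
  have hli : LinearIndependent ℂ ![α, β] := by
    rw [LinearIndependent.pair_iff' (ne_zero_of_mem hα)]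
    exact fun c hc => h c hc.symm
  rw [hspan, finrank_span_eq_card hli]
  simp

/-- `t_α` commutes with the sum of the `t_γ` over any `α`-string of roots. -/
lemma stringSum_eq_zero {α : Module.Dual ℂ H} (hα : α ∈ D.Φ) {β : Module.Dual ℂ H}
    (hβ : β ∈ D.Φ) (h : ∀ c : ℂ, β ≠ c • α) :
    D.stringSum α (β : Module.Dual ℂ H ⧸ AddSubgroup.zmultiples α) = 0 := by
  classical
  induction hn : (D.latticeRoots α β).ncard using Nat.strong_induction_on generalizing β with
  | _ n ih =>
  have key := TT_lie_sum (D := D) (Ψ := D.latticeRoots α β) (fun γ hγ => hγ.1)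
    (by
      rintro γ ⟨h1, i, j, rfl⟩
      exact ⟨D.neg_mem _ h1, -i, -j, by simp; abel⟩)
    (finrank_span_latticeRoots hα hβ h)
    (by
      rintro γ ⟨-, i, j, rfl⟩ γ' ⟨-, i', j', rfl⟩ hΦ
      exact ⟨hΦ, i + i', j + j', by simp [add_smul]; abel⟩)
    (α := α) ⟨hα, 1, 0, by simp⟩
  set mk : Module.Dual ℂ H → Module.Dual ℂ H ⧸ AddSubgroup.zmultiples α :=
    fun γ => (γ : Module.Dual ℂ H ⧸ AddSubgroup.zmultiples α) with hmk
  have hmk_eq : ∀ γ γ', mk γ = mk γ' ↔ ∃ i : ℤ, γ' = γ + i • α := by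
    intro γ γ'
    simp only [hmk]
    rw [QuotientAddGroup.eq, AddSubgroup.mem_zmultiples_iff]
    constructor
    · rintro ⟨i, hi⟩
      exact ⟨i, by rw [hi]; abel⟩
    · rintro ⟨i, rfl⟩
      exact ⟨i, by abel⟩
  set S := D.roots.filter (· ∈ D.latticeRoots α β) with hS
  have hsum : ∑ q ∈ S.image mk, D.stringSum α q = 0 := by
    rw [← key, ← Finset.sum_fiberwise_of_maps_to (s := S) (t := S.image mk) (g := mk)
      (fun γ hγ => Finset.mem_image_of_mem _ hγ)]
    refine Finset.sum_congr rfl fun q hq => ?_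
    rw [stringSum]
    refine Finset.sum_congr ?_ fun _ _ => rfl
    obtain ⟨γ', hγ', rfl⟩ := Finset.mem_image.1 hq
    obtain ⟨-, -, i, j, rfl⟩ := (by simpa [hS] using hγ' : _ ∧ _ ∈ D.latticeRoots α β)
    ext γ
    simp only [Finset.mem_filter, mem_roots, hS]
    constructor
    · rintro ⟨h1, h2⟩
      obtain ⟨k, hk⟩ := (hmk_eq _ _).1 h2.symm
      exact ⟨⟨h1, h1, i + k, j, by rw [hk, add_smul]; abel⟩, h2⟩
    · rintro ⟨⟨h1, -⟩, h2⟩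
      exact ⟨h1, h2⟩
  have hne : mk β ≠ mk (-β) := by
    intro e
    obtain ⟨i, hi⟩ := (hmk_eq _ _).1 e
    refine h (-(i : ℂ) / 2) ?_
    have h2 : (2 : ℂ) • β = (-(i : ℂ)) • α := by
      rw [neg_smul, Int.cast_smul_eq_zsmul, two_smul, ← sub_eq_zero]
      have := sub_eq_zero.2 hi
      rw [← neg_eq_zero, ← this]; abel
    rw [div_eq_inv_mul, mul_smul, ← h2, smul_smul]
    simp
  have hβS : β ∈ S := by exact Finset.mem_filter.2 ⟨by simpa using hβ, hβ, 0, 1, by simp⟩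
  have hnβS : -β ∈ S := by
    exact Finset.mem_filter.2 ⟨by simpa using D.neg_mem _ hβ, D.neg_mem _ hβ, 0, -1, by simp⟩
  have hzero : ∀ q ∈ S.image mk, q ∉ ({mk β, mk (-β)} : Finset _) → D.stringSum α q = 0 := by
    intro q hq hq'
    obtain ⟨γ, hγ, rfl⟩ := Finset.mem_image.1 hq
    have hγ' : γ ∈ D.Φ ∧ γ ∈ D.latticeRoots α β := by simpa [hS] using hγ
    obtain ⟨hγΦ, -, i, j, hij⟩ := hγ'
    by_cases hprop : ∃ c : ℂ, γ = c • α
    · obtain ⟨c, hc⟩ := hprop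
      refine Finset.sum_eq_zero fun δ hδ => ?_
      simp only [Finset.mem_filter, mem_roots] at hδ
      obtain ⟨k, hk⟩ := (hmk_eq _ _).1 hδ.2.symm
      refine TT_lie_eq_zero_of_smul hα hδ.1 (c := c + k) ?_
      rw [hk, hc, add_smul, Int.cast_smul_eq_zsmul]
    · push Not at hprop
      refine ih _ ?_ hγΦ hprop rfl
      rw [← hn]
      refine Set.ncard_lt_ncard ?_ (D.finite.subset fun δ hδ => hδ.1)
      refine Set.ssubset_iff_subset_ne.2 ⟨?_, ?_⟩
      · rintro δ ⟨h1, k, l, rfl⟩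
        exact ⟨h1, k + l * i, l * j, by rw [hij]; module⟩
      · intro e
        have hmem : β ∈ D.latticeRoots α γ := by
          rw [e]; exact ⟨hβ, 0, 1, by simp⟩
        obtain ⟨-, k, l, hkl⟩ := hmem
        have hlj : l * j = 1 := by
          by_contra hlj
          have hlj' : (1 - (l : ℂ) * j) ≠ 0 := by
            rw [sub_ne_zero]
            exact_mod_cast Ne.symm hlj
          refine h ((1 - (l : ℂ) * j)⁻¹ * (k + l * i)) ?_
          rw [mul_smul, eq_inv_smul_iff₀ hlj']
          rw [hij] at hkl
          have : (1 - (l : ℂ) * j) • β = β - (l * j) • β := by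
            rw [sub_smul, one_smul, ← Int.cast_mul, Int.cast_smul_eq_zsmul]
          rw [this]
          nth_rewrite 1 [hkl]
          rw [← Int.cast_mul, ← Int.cast_add, Int.cast_smul_eq_zsmul]
          module
        apply hq'
        simp only [Finset.mem_insert, Finset.mem_singleton]
        rcases Int.eq_one_or_neg_one_of_mul_eq_one (by rwa [mul_comm] at hlj : j * l = 1)
          with rfl | rfl
        · left
          exact (hmk_eq _ _).2 ⟨-i, by rw [hij]; module⟩
        · right
          exact (hmk_eq _ _).2 ⟨-i, by rw [hij]; module⟩
  have hsub : ({mk β, mk (-β)} : Finset _) ⊆ S.image mk := by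
    intro q hq
    simp only [Finset.mem_insert, Finset.mem_singleton] at hq
    rcases hq with rfl | rfl
    · exact Finset.mem_image_of_mem _ hβS
    · exact Finset.mem_image_of_mem _ hnβS
  rw [← Finset.sum_subset hsub hzero, Finset.sum_pair hne] at hsum
  have hneg : D.stringSum α (mk (-β)) = D.stringSum α (mk β) := stringSum_neg α (mk β)
  rw [hneg, ← two_smul ℂ] at hsum
  exact (smul_eq_zero.1 hsum).resolve_left two_ne_zero

end RootSystemData

section CothProduct

open Polynomial

/-- The Lagrange nodal polynomial of the solutions of `a * z ^ n = 1`. -/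
lemma nodal_roots_X_pow_sub_C {n : ℕ} (hn : 0 < n) {b : ℂ} (hb : b ≠ 0) :
    Lagrange.nodal (X ^ n - C b : ℂ[X]).roots.toFinset id = X ^ n - C b := by
  have hsep : (X ^ n - C b : ℂ[X]).Separable :=
    separable_X_pow_sub_C b (Nat.cast_ne_zero.mpr hn.ne') hb
  have hnodup := nodup_roots hsep
  have hmonic : (X ^ n - C b : ℂ[X]).Monic := monic_X_pow_sub_C b hn.ne'
  have hs := (IsAlgClosed.splits (X ^ n - C b : ℂ[X])).eq_prod_roots_of_monic hmonic
  conv_rhs => rw [hs]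
  rw [Lagrange.nodal, Finset.prod, Multiset.toFinset_val, hnodup.dedup]
  rfl

lemma mem_roots_X_pow_sub_C {n : ℕ} (hn : 0 < n) {a z : ℂ} (ha : a ≠ 0) :
    z ∈ (X ^ n - C a⁻¹ : ℂ[X]).roots.toFinset ↔ a * z ^ n = 1 := by
  rw [Multiset.mem_toFinset, mem_roots (monic_X_pow_sub_C _ hn.ne').ne_zero, IsRoot.def]
  simp only [eval_sub, eval_pow, eval_X, eval_C, sub_eq_zero]
  rw [← one_div, eq_div_iff ha, mul_comm]

/-- Partial fraction expansion at `z = 1` of the product of the functions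
`(a z ^ n + 1) / (a z ^ n - 1)` and `(b z ^ m + 1) / (b z ^ m - 1)`. -/
lemma coth_mul_coth_sub_one {a b : ℂ} {n m : ℕ} (hn : 0 < n) (hm : 0 < m)
    (ha : a ≠ 0) (hb : b ≠ 0) (ha1 : a ≠ 1) (hb1 : b ≠ 1)
    (hab : ∀ z : ℂ, a * z ^ n = 1 → b * z ^ m ≠ 1) :
    (a + 1) / (a - 1) * ((b + 1) / (b - 1)) - 1 =
      ∑ z ∈ (X ^ n - C a⁻¹ : ℂ[X]).roots.toFinset,
        2 * z / (n * (1 - z)) * ((b * z ^ m + 1) / (b * z ^ m - 1)) +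
      ∑ z ∈ (X ^ m - C b⁻¹ : ℂ[X]).roots.toFinset,
        2 * z / (m * (1 - z)) * ((a * z ^ n + 1) / (a * z ^ n - 1)) := by
  classical
  set A := (X ^ n - C a⁻¹ : ℂ[X]).roots.toFinset with hA
  set B := (X ^ m - C b⁻¹ : ℂ[X]).roots.toFinset with hB
  have memA : ∀ z, z ∈ A ↔ a * z ^ n = 1 := fun z => mem_roots_X_pow_sub_C hn ha
  have memB : ∀ z, z ∈ B ↔ b * z ^ m = 1 := fun z => mem_roots_X_pow_sub_C hm hb
  have hdisj : Disjoint A B := by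
    rw [Finset.disjoint_left]
    intro z hzA hzB
    exact hab z ((memA z).1 hzA) ((memB z).1 hzB)
  have nodA : Lagrange.nodal A id = X ^ n - C a⁻¹ :=
    nodal_roots_X_pow_sub_C hn (inv_ne_zero ha)
  have nodB : Lagrange.nodal B id = X ^ m - C b⁻¹ :=
    nodal_roots_X_pow_sub_C hm (inv_ne_zero hb)
  have cardA : A.card = n := by
    have := congrArg natDegree nodA
    rwa [Lagrange.natDegree_nodal, natDegree_X_pow_sub_C] at this
  have cardB : B.card = m := by
    have := congrArg natDegree nodB
    rwa [Lagrange.natDegree_nodal, natDegree_X_pow_sub_C] at this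
  have nodAB : Lagrange.nodal (A ∪ B) id = (X ^ n - C a⁻¹) * (X ^ m - C b⁻¹) := by
    rw [← nodA, ← nodB]
    simp only [Lagrange.nodal]
    rw [Finset.prod_union hdisj]
  set f : ℂ[X] := C (2 * a) * X ^ n + C (2 * b) * X ^ m with hf
  have hdeg : f.degree < (A ∪ B).card := by
    rw [Finset.card_union_of_disjoint hdisj, cardA, cardB]
    refine (degree_add_le _ _).trans_lt (max_lt ?_ ?_)
    · refine (degree_C_mul_X_pow_le _ _).trans_lt ?_
      exact_mod_cast Nat.lt_add_of_pos_right hm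
    · refine (degree_C_mul_X_pow_le _ _).trans_lt ?_
      exact_mod_cast Nat.lt_add_of_pos_left hn
  have hint := Lagrange.eq_interpolate (v := id) (Set.injOn_id _) hdeg
  have hone : ∀ z ∈ A ∪ B, (1 : ℂ) ≠ id z := by
    rintro z hz rfl
    rcases Finset.mem_union.1 hz with h | h
    · have := (memA _).1 h
      simp at this; exact ha1 this
    · have := (memB _).1 h
      simp at this; exact hb1 this
  have heval := congrArg (eval (1 : ℂ)) hint
  rw [Lagrange.eval_interpolate_not_at_node _ hone, Finset.sum_union hdisj, nodAB] at heval
  have ha1' : a - 1 ≠ 0 := sub_ne_zero.2 ha1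
  have hb1' : b - 1 ≠ 0 := sub_ne_zero.2 hb1
  have hderiv : ∀ z, eval z (derivative (Lagrange.nodal (A ∪ B) id)) =
      n * z ^ (n - 1) * (z ^ m - b⁻¹) + (z ^ n - a⁻¹) * (m * z ^ (m - 1)) := by
    intro z
    rw [nodAB]
    simp only [derivative_mul, derivative_sub, derivative_X_pow, derivative_C, eval_add,
      eval_mul, eval_sub, eval_pow, eval_X, eval_C, sub_zero]
  have termA : ∀ z ∈ A, Lagrange.nodalWeight (A ∪ B) id z * (1 - id z)⁻¹ * eval (id z) f =
      a * b * (2 * z / (n * (1 - z)) * ((b * z ^ m + 1) / (b * z ^ m - 1))) := by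
    intro z hz
    have h1 := (memA z).1 hz
    have h2 : b * z ^ m - 1 ≠ 0 := sub_ne_zero.2 (hab z h1)
    have h3 : (1 : ℂ) - z ≠ 0 := sub_ne_zero.2 (hone z (Finset.mem_union_left _ hz))
    have hz0 : z ≠ 0 := by rintro rfl; simp [hn.ne'] at h1
    have hn0 : (n : ℂ) ≠ 0 := Nat.cast_ne_zero.2 hn.ne'
    have e := hderiv z
    have h4 : z ^ n = a⁻¹ := by rw [← one_div, eq_div_iff ha, mul_comm]; exact h1
    have h5 : z ^ (n - 1) = a⁻¹ / z := by
      rw [eq_div_iff hz0, ← pow_succ, Nat.sub_add_cancel hn, h4]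
    have h6 : z ^ m - b⁻¹ = (b * z ^ m - 1) / b := by field_simp
    have e' : eval (id z) (derivative (Lagrange.nodal (A ∪ B) id)) =
        n * (a⁻¹ / z) * ((b * z ^ m - 1) / b) := by
      rw [id, e, h4, h5, h6]; ring
    rw [Lagrange.nodalWeight_eq_eval_derivative_nodal (Finset.mem_union_left _ hz), e']
    have h7 : eval (id z) f = 2 * (b * z ^ m + 1) := by
      simp only [hf, id, eval_add, eval_mul, eval_C, eval_pow, eval_X]
      linear_combination 2 * h1
    rw [h7, id]
    field_simp
  have termB : ∀ z ∈ B, Lagrange.nodalWeight (A ∪ B) id z * (1 - id z)⁻¹ * eval (id z) f =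
      a * b * (2 * z / (m * (1 - z)) * ((a * z ^ n + 1) / (a * z ^ n - 1))) := by
    intro z hz
    have h1 := (memB z).1 hz
    have h2 : a * z ^ n - 1 ≠ 0 := sub_ne_zero.2 (fun h => hab z h h1)
    have h3 : (1 : ℂ) - z ≠ 0 := sub_ne_zero.2 (hone z (Finset.mem_union_right _ hz))
    have hz0 : z ≠ 0 := by rintro rfl; simp [hm.ne'] at h1
    have hm0 : (m : ℂ) ≠ 0 := Nat.cast_ne_zero.2 hm.ne'
    have e := hderiv z
    have h4 : z ^ m = b⁻¹ := by rw [← one_div, eq_div_iff hb, mul_comm]; exact h1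
    have h5 : z ^ (m - 1) = b⁻¹ / z := by
      rw [eq_div_iff hz0, ← pow_succ, Nat.sub_add_cancel hm, h4]
    have h6 : z ^ n - a⁻¹ = (a * z ^ n - 1) / a := by field_simp
    have e' : eval (id z) (derivative (Lagrange.nodal (A ∪ B) id)) =
        m * (b⁻¹ / z) * ((a * z ^ n - 1) / a) := by
      rw [id, e, h4, h5, h6]; ring
    rw [Lagrange.nodalWeight_eq_eval_derivative_nodal (Finset.mem_union_right _ hz), e']
    have h7 : eval (id z) f = 2 * (a * z ^ n + 1) := by
      simp only [hf, id, eval_add, eval_mul, eval_C, eval_pow, eval_X]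
      linear_combination 2 * h1
    rw [h7, id]
    field_simp
  rw [Finset.sum_congr rfl termA, Finset.sum_congr rfl termB, ← Finset.mul_sum,
    ← Finset.mul_sum, ← mul_add] at heval
  simp only [hf, eval_add, eval_mul, eval_C, eval_pow, eval_X, eval_sub, one_pow] at heval
  generalize (∑ z ∈ A, 2 * z / (n * (1 - z)) * ((b * z ^ m + 1) / (b * z ^ m - 1)) +
      ∑ z ∈ B, 2 * z / (m * (1 - z)) * ((a * z ^ n + 1) / (a * z ^ n - 1)) : ℂ) = T at heval ⊢
  field_simp at heval ⊢
  linear_combination heval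

end CothProduct
namespace RootSystemData

variable {H : Type} [AddCommGroup H] [Module ℂ H] {D : RootSystemData H}

lemma mem_rootLattice {α : Module.Dual ℂ H} (h : α ∈ D.Φ) : α ∈ D.rootLattice :=
  AddSubgroup.subset_closure h

lemma toruseval_ne_zero (C : D.Torus) (α : Module.Dual ℂ H) : D.toruseval C α ≠ 0 := by
  rw [toruseval]
  split_ifs
  · exact Units.ne_zero _
  · exact one_ne_zero

lemma toruseval_add (C : D.Torus) {α β : Module.Dual ℂ H} (hα : α ∈ D.rootLattice)
    (hβ : β ∈ D.rootLattice) :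
    D.toruseval C (α + β) = D.toruseval C α * D.toruseval C β := by
  rw [toruseval, toruseval, toruseval, dif_pos hα, dif_pos hβ, dif_pos (add_mem hα hβ),
    ← Units.val_mul, ← toMul_add, ← map_add]
  rfl

lemma toruseval_neg (C : D.Torus) {α : Module.Dual ℂ H} (hα : α ∈ D.rootLattice) :
    D.toruseval C (-α) = (D.toruseval C α)⁻¹ := by
  rw [toruseval, toruseval, dif_pos hα, dif_pos (AddSubgroup.neg_mem _ hα), ← Units.val_inv_eq_inv_val,
    ← toMul_neg, ← map_neg]
  rfl

lemma toruseval_zsmul (C : D.Torus) {α : Module.Dual ℂ H} (hα : α ∈ D.rootLattice) (i : ℤ) :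
    D.toruseval C (i • α) = D.toruseval C α ^ i := by
  rw [toruseval, toruseval, dif_pos hα, dif_pos (zsmul_mem hα i), ← Units.val_zpow_eq_zpow_val,
    ← toMul_zsmul, ← map_zsmul]
  rfl

variable (D) in
/-- The element `exp w` of the torus. -/
def expTorus (w : H) : D.Torus where
  toFun x := Additive.ofMul
    (Units.mk0 (Complex.exp ((x : Module.Dual ℂ H) w)) (Complex.exp_ne_zero _))
  map_zero' := by
    rw [← ofMul_one]
    congr 1
    ext
    simp
  map_add' x y := by
    rw [← ofMul_mul]
    congr 1
    ext
    simp [Complex.exp_add]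

lemma toruseval_add_expTorus (C : D.Torus) (w : H) {α : Module.Dual ℂ H}
    (hα : α ∈ D.rootLattice) :
    D.toruseval (C + D.expTorus w) α = D.toruseval C α * Complex.exp (α w) := by
  rw [toruseval, toruseval, dif_pos hα, dif_pos hα]
  simp [expTorus]

/-- The residue of the commutator of two Bethe Hamiltonians along `e^α = 1` vanishes. -/
lemma sum_coth_smul_lie_eq_zero (C : D.Torus) {α : Module.Dual ℂ H} (hα : α ∈ D.Φ)
    (h1 : D.toruseval C α = 1) (v w : H) :
    ∑ β ∈ D.posRoots, ((D.toruseval C β + 1) / (D.toruseval C β - 1) *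
      (α v * β w - α w * β v)) • ⁅D.TT α, D.TT β⁆ = 0 := by
  classical
  set y : Module.Dual ℂ H → D.Trig := fun β =>
    ((D.toruseval C β + 1) / (D.toruseval C β - 1) * (α v * β w - α w * β v)) •
      ⁅D.TT α, D.TT β⁆ with hy
  have heven : ∀ β ∈ D.Φ, y (-β) = y β := by
    intro β hβ
    simp only [hy, TT_neg hβ]
    congr 1
    rw [toruseval_neg C (mem_rootLattice hβ)]
    have h0 := toruseval_ne_zero C β
    by_cases hb : D.toruseval C β = 1
    · simp [hb]
    have hb' : D.toruseval C β - 1 ≠ 0 := sub_ne_zero.2 hb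
    have hb'' : (D.toruseval C β)⁻¹ - 1 ≠ 0 := by
      rw [sub_ne_zero]; simpa using hb
    have : ((D.toruseval C β)⁻¹ + 1) / ((D.toruseval C β)⁻¹ - 1) =
        -((D.toruseval C β + 1) / (D.toruseval C β - 1)) := by
      rw [← neg_div_neg_eq, ← neg_div, div_eq_div_iff (neg_ne_zero.2 hb'') hb']
      field_simp
      ring
    rw [this]
    simp only [LinearMap.neg_apply]
    ring
  have htwo := sum_roots_eq_two_smul D Set.univ (fun _ => by simp) y heven
  simp only [Set.mem_univ, Finset.filter_true] at htwo
  suffices h : ∑ β ∈ D.roots, y β = 0 by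
    rw [h, ← Nat.cast_smul_eq_nsmul ℂ] at htwo
    exact (smul_eq_zero.1 htwo.symm).resolve_left (by norm_num)
  rw [← Finset.sum_fiberwise_of_maps_to (t := D.roots.image (fun γ : Module.Dual ℂ H =>
    (QuotientAddGroup.mk γ : Module.Dual ℂ H ⧸ AddSubgroup.zmultiples α)))
    (fun γ hγ => Finset.mem_image_of_mem _ hγ)]
  refine Finset.sum_eq_zero fun q hq => ?_
  obtain ⟨β, hβ, rfl⟩ := Finset.mem_image.1 hq
  rw [mem_roots] at hβ
  have hstep : ∀ γ ∈ D.roots.filter (fun γ : Module.Dual ℂ H =>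
      (QuotientAddGroup.mk γ : Module.Dual ℂ H ⧸ AddSubgroup.zmultiples α) =
        QuotientAddGroup.mk β), y γ =
      ((D.toruseval C β + 1) / (D.toruseval C β - 1) * (α v * β w - α w * β v)) •
      ⁅D.TT α, D.TT γ⁆ := by
    intro γ hγ
    obtain ⟨-, hq⟩ := Finset.mem_filter.1 hγ
    have hq' := QuotientAddGroup.eq.1 hq.symm
    obtain ⟨i, hi⟩ := AddSubgroup.mem_zmultiples_iff.1 hq'
    have hγ' : γ = β + i • α := by rw [hi]; abel
    have hev : D.toruseval C γ = D.toruseval C β := by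
      rw [hγ', toruseval_add C (mem_rootLattice hβ) (zsmul_mem (mem_rootLattice hα) i),
        toruseval_zsmul C (mem_rootLattice hα), h1, one_zpow, mul_one]
    simp only [hy, hev]
    congr 2
    rw [hγ']
    simp only [LinearMap.add_apply, LinearMap.smul_apply, zsmul_eq_mul]
    ring
  rw [Finset.sum_congr rfl hstep, ← Finset.smul_sum]
  by_cases hprop : ∃ c : ℂ, β = c • α
  · obtain ⟨c, rfl⟩ := hprop
    simp only [LinearMap.smul_apply, smul_eq_mul]
    rw [show α v * (c * α w) - α w * (c * α v) = 0 by ring, mul_zero, zero_smul]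
  · push Not at hprop
    have := stringSum_eq_zero hα hβ hprop
    rw [stringSum] at this
    rw [this, smul_zero]

/-- The function `(u + 1) / (u - 1)`. -/
def cothExp (u : ℂ) : ℂ := (u + 1) / (u - 1)

/-- The vanishing of the quadratic form in the `cothExp (e^α(C))` for generic `C`. -/
lemma sum_cothExp_mul_eq_zero_of_generic (C : D.Torus) (hC : D.IsRegularTorus C)
    {x : Module.Dual ℂ H → Module.Dual ℂ H → ℂ}
    (hsymm : ∀ α β, x α β = x β α) (hdiag : ∀ α, x α α = 0)
    (hres : ∀ C' : D.Torus, ∀ α ∈ D.Φ, D.toruseval C' α = 1 →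
      ∑ β ∈ D.posRoots, cothExp (D.toruseval C' β) * x α β = 0)
    {h : H} {n : Module.Dual ℂ H → ℕ} (hn : ∀ α ∈ D.Φplus, 0 < n α ∧ α h = n α)
    (hgen : ∀ α ∈ D.Φplus, ∀ β ∈ D.Φplus, α ≠ β → ∀ z : ℂ,
      D.toruseval C α * z ^ n α = 1 → D.toruseval C β * z ^ n β ≠ 1) :
    ∑ α ∈ D.posRoots, ∑ β ∈ D.posRoots,
      (cothExp (D.toruseval C α) * cothExp (D.toruseval C β) - 1) * x α β = 0 := by
  classical
  set A : Module.Dual ℂ H → Finset ℂ := fun α =>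
    (Polynomial.X ^ n α - Polynomial.C (D.toruseval C α)⁻¹ : Polynomial ℂ).roots.toFinset with hA
  set T : Module.Dual ℂ H → Module.Dual ℂ H → ℂ := fun α β =>
    ∑ z ∈ A α, 2 * z / (n α * (1 - z)) * cothExp (D.toruseval C β * z ^ n β) * x α β with hT
  have hterm : ∀ α ∈ D.posRoots, ∀ β ∈ D.posRoots,
      (cothExp (D.toruseval C α) * cothExp (D.toruseval C β) - 1) * x α β = T α β + T β α := by
    intro α hα β hβ
    rw [mem_posRoots] at hα hβ
    by_cases hαβ : α = β
    · subst hαβ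
      simp [hT, hdiag]
    · have key := coth_mul_coth_sub_one (hn α hα).1 (hn β hβ).1 (toruseval_ne_zero C α)
        (toruseval_ne_zero C β) (hC α (D.plus_subset hα)) (hC β (D.plus_subset hβ))
        (hgen α hα β hβ hαβ)
      simp only [cothExp, hT, hA]
      rw [key, hsymm β α, add_mul, Finset.sum_mul, Finset.sum_mul]
  have hTzero : ∀ α ∈ D.posRoots, ∑ β ∈ D.posRoots, T α β = 0 := by
    intro α hα
    rw [mem_posRoots] at hα
    simp only [hT]
    rw [Finset.sum_comm]
    refine Finset.sum_eq_zero fun z hz => ?_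
    rw [mem_roots_X_pow_sub_C (hn α hα).1 (toruseval_ne_zero C α)] at hz
    have hz0 : z ≠ 0 := by
      rintro rfl
      rw [zero_pow (hn α hα).1.ne', mul_zero] at hz
      exact zero_ne_one hz
    have hev : ∀ β ∈ D.Φplus,
        D.toruseval (C + D.expTorus (Complex.log z • h)) β = D.toruseval C β * z ^ n β := by
      intro β hβ
      rw [toruseval_add_expTorus C _ (mem_rootLattice (D.plus_subset hβ)), map_smul,
        (hn β hβ).2, smul_eq_mul, mul_comm (Complex.log z), Complex.exp_nat_mul,
        Complex.exp_log hz0]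
    have := hres (C + D.expTorus (Complex.log z • h)) α (D.plus_subset hα) (by rw [hev α hα, hz])
    calc _ = 2 * z / (n α * (1 - z)) * ∑ β ∈ D.posRoots,
          cothExp (D.toruseval (C + D.expTorus (Complex.log z • h)) β) * x α β := by
          rw [Finset.mul_sum]
          refine Finset.sum_congr rfl fun β hβ => ?_
          rw [hev β (mem_posRoots.1 hβ), mul_assoc]
      _ = 0 := by rw [this, mul_zero]
  rw [Finset.sum_congr rfl fun α hα => Finset.sum_congr rfl fun β hβ => hterm α hα β hβ]
  simp only [Finset.sum_add_distrib]
  rw [Finset.sum_eq_zero hTzero, Finset.sum_comm, Finset.sum_eq_zero hTzero, add_zero]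

/-- The vanishing of the quadratic form in the `cothExp (e^α(C))` for regular `C`. -/
lemma sum_cothExp_mul_eq_zero (C : D.Torus) (hC : D.IsRegularTorus C)
    {x : Module.Dual ℂ H → Module.Dual ℂ H → ℂ}
    (hsymm : ∀ α β, x α β = x β α) (hdiag : ∀ α, x α α = 0)
    (hres : ∀ C' : D.Torus, ∀ α ∈ D.Φ, D.toruseval C' α = 1 →
      ∑ β ∈ D.posRoots, cothExp (D.toruseval C' β) * x α β = 0)
    {h : H} {n : Module.Dual ℂ H → ℕ} (hn : ∀ α ∈ D.Φplus, 0 < n α ∧ α h = n α) :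
    ∑ α ∈ D.posRoots, ∑ β ∈ D.posRoots,
      (cothExp (D.toruseval C α) * cothExp (D.toruseval C β) - 1) * x α β = 0 := by
  classical
  have hne : ∀ α ∈ D.Φplus, ∀ β ∈ D.Φplus, α ≠ β → (n β : ℂ) • α - (n α : ℂ) • β ≠ 0 := by
    intro α hα β hβ hαβ he
    have hnα : (n α : ℂ) ≠ 0 := Nat.cast_ne_zero.2 (hn α hα).1.ne'
    have hβα : β = ((n α : ℂ)⁻¹ * n β) • α := by
      rw [mul_smul, eq_inv_smul_iff₀ hnα]
      exact (sub_eq_zero.1 he).symm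
    rcases eq_or_eq_neg_of_smul (D.plus_subset hα) (D.plus_subset hβ) hβα with h | h
    · exact hαβ h.symm
    · exact neg_notMem_plus hα (h ▸ hβ)
  obtain ⟨u, hu⟩ : ∃ u : H, ∀ p : {p : Module.Dual ℂ H × Module.Dual ℂ H //
      p ∈ D.posRoots ×ˢ D.posRoots ∧ p.1 ≠ p.2},
      ((n p.1.2 : ℂ) • p.1.1 - (n p.1.1 : ℂ) • p.1.2) u ≠ 0 := by
    have : Finite {p : Module.Dual ℂ H × Module.Dual ℂ H //
      p ∈ D.posRoots ×ˢ D.posRoots ∧ p.1 ≠ p.2} :=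
      Set.Finite.subset (D.posRoots ×ˢ D.posRoots).finite_toSet (fun p hp => hp.1)
    refine Module.Dual.exists_forall_ne_zero_of_forall_exists
      (fun p : {p : Module.Dual ℂ H × Module.Dual ℂ H //
        p ∈ D.posRoots ×ˢ D.posRoots ∧ p.1 ≠ p.2} =>
        (n p.1.2 : ℂ) • p.1.1 - (n p.1.1 : ℂ) • p.1.2) ?_
    rintro ⟨⟨α, β⟩, hp, hαβ⟩
    simp only [Finset.mem_product, mem_posRoots] at hp
    by_contra! hc
    exact hne α hp.1 β hp.2 hαβ (LinearMap.ext hc)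
  have hev : ∀ (s : ℂ), ∀ α ∈ D.Φ, D.toruseval (C + D.expTorus (s • u)) α =
      D.toruseval C α * Complex.exp (s * α u) := by
    intro s α hα
    rw [toruseval_add_expTorus C _ (mem_rootLattice hα), map_smul, smul_eq_mul]
  set F : ℂ → ℂ := fun s => ∑ α ∈ D.posRoots, ∑ β ∈ D.posRoots,
    (cothExp (D.toruseval C α * Complex.exp (s * α u)) *
      cothExp (D.toruseval C β * Complex.exp (s * β u)) - 1) * x α β with hF
  have hcont : ContinuousAt F 0 := by
    have hc : ∀ α ∈ D.posRoots, ContinuousAt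
        (fun s : ℂ => cothExp (D.toruseval C α * Complex.exp (s * α u))) 0 := by
      intro α hα
      unfold cothExp
      refine ContinuousAt.div (by fun_prop) (by fun_prop) ?_
      simpa [sub_ne_zero] using hC α (D.plus_subset (mem_posRoots.1 hα))
    refine tendsto_finsetSum _ fun α hα => tendsto_finsetSum _ fun β hβ => ?_
    exact (((hc α hα).mul (hc β hβ)).sub continuousAt_const).mul continuousAt_const
  have hreg : ∀ᶠ s in nhdsWithin (0 : ℂ) {0}ᶜ, D.IsRegularTorus (C + D.expTorus (s • u)) := by
    refine Filter.Eventually.filter_mono nhdsWithin_le_nhds ?_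
    have : ∀ᶠ s in nhds (0 : ℂ), ∀ α ∈ D.Φ, D.toruseval C α * Complex.exp (s * α u) ≠ 1 := by
      rw [Filter.eventually_all_finite D.finite]
      intro α hα
      refine ContinuousAt.eventually_ne (by fun_prop) ?_
      simpa using hC α hα
    filter_upwards [this] with s hs α hα
    rw [hev s α hα]
    exact hs α hα
  have hgen : ∀ᶠ s in nhdsWithin (0 : ℂ) {0}ᶜ, ∀ α ∈ D.Φplus, ∀ β ∈ D.Φplus, α ≠ β → ∀ z : ℂ,
      D.toruseval (C + D.expTorus (s • u)) α * z ^ n α = 1 →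
      D.toruseval (C + D.expTorus (s • u)) β * z ^ n β ≠ 1 := by
    rw [Filter.eventually_all_finite D.plus_finite]
    intro α hα
    rw [Filter.eventually_all_finite D.plus_finite]
    intro β hβ
    by_cases hαβ : α = β
    · simp [hαβ]
    have hμ := hu ⟨(α, β), by simpa using ⟨hα, hβ⟩, hαβ⟩
    simp only [LinearMap.sub_apply, LinearMap.smul_apply, smul_eq_mul] at hμ
    set μ : ℂ := n β * α u - n α * β u with hμdef
    set K : ℂ := D.toruseval C α ^ n β / D.toruseval C β ^ n α with hK
    have hK0 : K ≠ 0 := div_ne_zero (pow_ne_zero _ (toruseval_ne_zero C α))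
      (pow_ne_zero _ (toruseval_ne_zero C β))
    have hd : HasDerivAt (fun s : ℂ => K * Complex.exp (s * μ))
        (K * (Complex.exp (0 * μ) * (1 * μ))) 0 :=
      (((hasDerivAt_id (0 : ℂ)).mul_const μ).cexp).const_mul K
    have hev1 := hd.eventually_ne (c := 1) (by simpa using ⟨hK0, hμ⟩)
    filter_upwards [hev1] with s hs _ z h1 h2
    apply hs
    rw [hev s α (D.plus_subset hα)] at h1
    rw [hev s β (D.plus_subset hβ)] at h2
    have e1 : (D.toruseval C α * Complex.exp (s * α u)) ^ n β * z ^ (n α * n β) = 1 := by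
      rw [pow_mul, ← mul_pow, h1, one_pow]
    have e2 : (D.toruseval C β * Complex.exp (s * β u)) ^ n α * z ^ (n α * n β) = 1 := by
      rw [mul_comm (n α), pow_mul, ← mul_pow, h2, one_pow]
    have hz : z ^ (n α * n β) ≠ 0 := right_ne_zero_of_mul_eq_one e1
    have e3 := mul_right_cancel₀ hz (e1.trans e2.symm)
    rw [mul_pow, mul_pow, ← Complex.exp_nat_mul, ← Complex.exp_nat_mul] at e3
    have e4 : Complex.exp (s * μ) =
        Complex.exp (n β * (s * α u)) / Complex.exp (n α * (s * β u)) := by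
      rw [← Complex.exp_sub, hμdef]
      congr 1
      ring
    rw [e4, hK, div_mul_div_comm, e3, div_self]
    exact mul_ne_zero (pow_ne_zero _ (toruseval_ne_zero C β)) (Complex.exp_ne_zero _)
  have hFzero : ∀ᶠ s in nhdsWithin (0 : ℂ) {0}ᶜ, F s = 0 := by
    filter_upwards [hreg, hgen] with s hs1 hs2
    rw [← sum_cothExp_mul_eq_zero_of_generic (C + D.expTorus (s • u)) hs1 hsymm hdiag hres hn hs2]
    refine Finset.sum_congr rfl fun α hα => Finset.sum_congr rfl fun β hβ => ?_
    rw [hev s α (D.plus_subset (mem_posRoots.1 hα)), hev s β (D.plus_subset (mem_posRoots.1 hβ))]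
  have hlim : Filter.Tendsto F (nhdsWithin 0 {0}ᶜ) (nhds (F 0)) :=
    hcont.tendsto.mono_left nhdsWithin_le_nhds
  have hF0 : F 0 = 0 := tendsto_nhds_unique hlim
    (tendsto_const_nhds.congr' (hFzero.mono fun s hs => hs.symm))
  simpa [hF] using hF0

end RootSystemData

namespace RootSystemData

variable {H : Type} [AddCommGroup H] [Module ℂ H] {D : RootSystemData H}

/-- The chosen coroot of a root. -/
def coroot {α : Module.Dual ℂ H} (hα : α ∈ D.Φ) : H := (D.coroot_exists α hα).choose

lemma apply_coroot_self {α : Module.Dual ℂ H} (hα : α ∈ D.Φ) : α (coroot hα) = 2 :=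
  (D.coroot_exists α hα).choose_spec.1

lemma sub_smul_mem {α β : Module.Dual ℂ H} (hα : α ∈ D.Φ) (hβ : β ∈ D.Φ) :
    β - β (coroot hα) • α ∈ D.Φ :=
  ((D.coroot_exists α hα).choose_spec.2 β hβ).1

lemma exists_int_eq {α β : Module.Dual ℂ H} (hα : α ∈ D.Φ) (hβ : β ∈ D.Φ) :
    ∃ m : ℤ, β (coroot hα) = m :=
  ((D.coroot_exists α hα).choose_spec.2 β hβ).2

lemma coroot_injective {α β : Module.Dual ℂ H} (hα : α ∈ D.Φ) (hβ : β ∈ D.Φ)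
    (h : coroot hα = coroot hβ) : α = β := by
  by_contra hne
  have hα2 := apply_coroot_self hα
  have hβ2 := apply_coroot_self hβ
  have hβα : β (coroot hα) = 2 := by rw [h]; exact hβ2
  have hmem : ∀ k : ℕ, β + (2 * k : ℂ) • (β - α) ∈ D.Φ := by
    intro k
    induction k with
    | zero => simpa using hβ
    | succ k ih =>
      have h1 := sub_smul_mem hα ih
      have h2 := sub_smul_mem hβ h1
      rw [← h] at h2
      convert h2 using 1
      simp only [LinearMap.add_apply, LinearMap.sub_apply, LinearMap.smul_apply, hα2, hβα,
        smul_eq_mul]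
      push_cast
      module
  have hinf : Set.Infinite (Set.range fun k : ℕ => β + (2 * k : ℂ) • (β - α)) := by
    refine Set.infinite_range_of_injective fun k l hkl => ?_
    have := smul_left_injective ℂ (sub_ne_zero.2 (Ne.symm hne)) (add_left_cancel hkl)
    simpa using this
  exact hinf (D.finite.subset (by rintro _ ⟨k, rfl⟩; exact hmem k))

/-- If the pairing of two distinct roots is positive, their difference is a root. -/
lemma sub_mem_of_pairing_pos [FiniteDimensional ℂ H] {α β : Module.Dual ℂ H} (hα : α ∈ D.Φ)
    (hβ : β ∈ D.Φ) (hne : β ≠ α) {m : ℤ} (hm : β (coroot hα) = m) (hpos : 0 < m) :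
    β - α ∈ D.Φ := by
  have : Finite D.Φ := D.finite
  let root : ↥D.Φ ↪ Module.Dual ℂ H := Function.Embedding.subtype _
  let cor : ↥D.Φ ↪ H :=
    ⟨fun γ => coroot γ.2, fun γ δ h => Subtype.ext (coroot_injective γ.2 δ.2 h)⟩
  have hrange : Set.range root = D.Φ := Subtype.range_coe
  let P : RootPairing ↥D.Φ ℂ (Module.Dual ℂ H) H :=
    RootPairing.mk'' (LinearMap.id : Module.Dual ℂ H →ₗ[ℂ] H →ₗ[ℂ] ℂ) root cor
      (fun γ => apply_coroot_self γ.2)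
      (by
        intro γ δ hδ
        rw [hrange] at hδ ⊢
        exact sub_smul_mem γ.2 hδ)
      (by rw [hrange]; exact D.spans)
  have hcrys : P.IsCrystallographic := ⟨fun γ δ => by
    obtain ⟨k, hk⟩ := exists_int_eq δ.2 γ.2
    exact ⟨k, hk.symm⟩⟩
  have hpair : P.pairingIn ℤ ⟨β, hβ⟩ ⟨α, hα⟩ = m := by
    have := P.algebraMap_pairingIn ℤ ⟨β, hβ⟩ ⟨α, hα⟩
    have h2 : P.pairing ⟨β, hβ⟩ ⟨α, hα⟩ = m := hm
    rw [h2] at this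
    exact Int.cast_injective (α := ℂ) (by simpa using this)
  have := P.root_sub_root_mem_of_pairingIn_pos (i := ⟨β, hβ⟩) (j := ⟨α, hα⟩)
    (by rw [hpair]; exact hpos) (by simpa using hne)
  obtain ⟨γ, hγ⟩ := this
  have e : (γ : Module.Dual ℂ H) = β - α := hγ
  rw [← e]
  exact γ.2

/-- A coweight on which no root vanishes. -/
lemma exists_regular_coweight (D : RootSystemData H) :
    ∃ h : H, ∀ β ∈ D.Φ, ∃ m : ℤ, m ≠ 0 ∧ β h = m := by
  classical
  suffices hS : ∀ S : Finset (Module.Dual ℂ H), ↑S ⊆ D.Φ →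
      ∃ h : H, (∀ β ∈ D.Φ, ∃ m : ℤ, β h = m) ∧ ∀ β ∈ S, β h ≠ 0 by
    obtain ⟨h, h1, h2⟩ := hS D.roots (fun β hβ => by simpa using hβ)
    refine ⟨h, fun β hβ => ?_⟩
    obtain ⟨m, hm⟩ := h1 β hβ
    refine ⟨m, ?_, hm⟩
    rintro rfl
    exact h2 β (by simpa using hβ) (by simpa using hm)
  intro S
  induction S using Finset.induction_on with
  | empty => exact fun _ => ⟨0, fun β _ => ⟨0, by simp⟩, by simp⟩
  | insert γ S hγS ih =>
    intro hS
    obtain ⟨h, h1, h2⟩ := ih (fun β hβ => hS (by simp [Finset.mem_coe.1 hβ]))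
    have hγ : γ ∈ D.Φ := hS (by simp)
    by_cases hγh : γ h = 0
    · have hZ : Set.Infinite (Set.range (fun k : ℤ => (k : ℂ))) :=
        Set.infinite_range_of_injective Int.cast_injective
      obtain ⟨_, ⟨k, rfl⟩, hk⟩ := hZ.exists_notMem_finset
        (S.image fun β => -(β (coroot hγ)) / β h)
      refine ⟨coroot hγ + k • h, fun β hβ => ?_, fun β hβ => ?_⟩
      · obtain ⟨a, ha⟩ := exists_int_eq hγ hβ
        obtain ⟨b, hb⟩ := h1 β hβ
        exact ⟨a + k * b, by simp [ha, hb]⟩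
      · rw [map_add, map_zsmul, zsmul_eq_mul]
        rcases Finset.mem_insert.1 hβ with rfl | hβS
        · rw [hγh, apply_coroot_self]; norm_num
        · intro h0
          refine hk (Finset.mem_image.2 ⟨β, hβS, ?_⟩)
          rw [div_eq_iff (h2 β hβS)]
          linear_combination -h0
    · refine ⟨h, h1, fun β hβ => ?_⟩
      rcases Finset.mem_insert.1 hβ with rfl | hβS
      · exact hγh
      · exact h2 β hβS

/-- A multiple of an indecomposable root `α` for the positive system defined by `h` is not the sum
of two other roots which are positive on `h` and pair positively with the coroot of `α`. -/
lemma no_sum_eq_smul [FiniteDimensional ℂ H] {h : H}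
    (hh : ∀ β ∈ D.Φ, ∃ m : ℤ, m ≠ 0 ∧ β h = m) {α : Module.Dual ℂ H} (hα : α ∈ D.Φ)
    (hαpos : 0 < (α h).re)
    (hind : ∀ β ∈ D.Φ, ∀ γ ∈ D.Φ, 0 < (β h).re → 0 < (γ h).re → α ≠ β + γ) (n : ℕ) :
    ∀ β ∈ D.Φ, ∀ γ ∈ D.Φ, 0 < (β h).re → 0 < (γ h).re → β ≠ α → γ ≠ α →
      β (coroot hα) = n → 0 < n → β + γ ≠ (n : ℂ) • α := by
  have hsub : ∀ β ∈ D.Φ, 0 < (β h).re → β - α ∈ D.Φ → 0 < ((β - α) h).re := by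
    intro β hβ hβpos hmem
    by_contra hneg
    obtain ⟨m, hm0, hm⟩ := hh _ hmem
    have hne : ((β - α) h).re ≠ 0 := by rw [hm]; simpa using hm0
    have hlt : ((β - α) h).re < 0 := lt_of_le_of_ne (not_lt.1 hneg) hne
    refine hind β hβ (-(β - α)) (D.neg_mem _ hmem) hβpos ?_ (by abel)
    rw [LinearMap.neg_apply, Complex.neg_re]
    linarith
  induction n using Nat.strong_induction_on with
  | _ n ih =>
  intro β hβ γ hγ hβpos hγpos hβα hγα hpair hn hsum
  have hγeq : γ = (n : ℂ) • α - β := by rw [← hsum]; abel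
  have hpairγ : γ (coroot hα) = n := by
    rw [hγeq, LinearMap.sub_apply, LinearMap.smul_apply, apply_coroot_self, hpair, smul_eq_mul]
    ring
  have hβ' := sub_mem_of_pairing_pos hα hβ hβα (m := n) (by simpa using hpair) (by exact_mod_cast hn)
  have hγ' := sub_mem_of_pairing_pos hα hγ hγα (m := n) (by simpa using hpairγ)
    (by exact_mod_cast hn)
  have hβ'pos := hsub β hβ hβpos hβ'
  have hγ'pos := hsub γ hγ hγpos hγ'
  have hsum' : (β - α) + (γ - α) = ((n : ℂ) - 2) • α := by rw [hγeq]; module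
  have hn2 : 2 < n := by
    by_contra hle
    have h1 : (((β - α) + (γ - α)) h).re = ((n : ℝ) - 2) * (α h).re := by
      rw [hsum']
      simp
    rw [LinearMap.add_apply, Complex.add_re] at h1
    have h2 : (n : ℝ) ≤ 2 := by exact_mod_cast not_lt.1 hle
    nlinarith
  have hnot : ∀ δ ∈ D.Φ, δ - α ≠ α := by
    intro δ hδ he
    have hδ2 : δ = (2 : ℂ) • α := by rw [two_smul]; exact sub_eq_iff_eq_add.1 he
    rcases D.reduced α hα 2 (hδ2 ▸ hδ) with h | h <;> norm_num at h
  have hcast : ((n - 2 : ℕ) : ℂ) = (n : ℂ) - 2 := by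
    rw [Nat.cast_sub hn2.le]; norm_num
  refine ih (n - 2) (by omega) (β - α) hβ' (γ - α) hγ' hβ'pos hγ'pos (hnot β hβ) (hnot γ hγ) ?_
    (by omega) (by rw [hsum', hcast])
  rw [LinearMap.sub_apply, hpair, apply_coroot_self, hcast]

/-- The reflection in an indecomposable root `α` for the positive system defined by `h` permutes
the other roots which are positive on `h`. -/
lemma reflection_pos [FiniteDimensional ℂ H] {h : H}
    (hh : ∀ β ∈ D.Φ, ∃ m : ℤ, m ≠ 0 ∧ β h = m) {α : Module.Dual ℂ H} (hα : α ∈ D.Φ)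
    (hαpos : 0 < (α h).re)
    (hind : ∀ β ∈ D.Φ, ∀ γ ∈ D.Φ, 0 < (β h).re → 0 < (γ h).re → α ≠ β + γ)
    {β : Module.Dual ℂ H} (hβ : β ∈ D.Φ) (hβpos : 0 < (β h).re) (hβα : β ≠ α) :
    0 < ((β - β (coroot hα) • α) h).re := by
  obtain ⟨m, hm⟩ := exists_int_eq hα hβ
  by_contra hneg
  have hmem := sub_smul_mem hα hβ
  have hlt : ((β - β (coroot hα) • α) h).re < 0 := by
    refine lt_of_le_of_ne (not_lt.1 hneg) ?_
    obtain ⟨k, hk0, hk⟩ := hh _ hmem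
    rw [hk]
    simpa using hk0
  have hmpos : 0 < m := by
    by_contra hm0
    have h1 : ((β - β (coroot hα) • α) h).re = (β h).re - m * (α h).re := by
      simp [hm]
    have h2 : (m : ℝ) ≤ 0 := by exact_mod_cast not_lt.1 hm0
    nlinarith
  obtain ⟨n, rfl⟩ := Int.eq_ofNat_of_zero_le hmpos.le
  rw [hm] at hmem hlt
  refine no_sum_eq_smul hh hα hαpos hind n β hβ _ (D.neg_mem _ hmem) hβpos ?_ hβα ?_
    (by simpa using hm) (by exact_mod_cast hmpos) (by simp)
  · rw [LinearMap.neg_apply, Complex.neg_re]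
    linarith
  · intro he
    have hβe : β = ((n : ℂ) - 1) • α := by
      have : β = ((n : ℤ) : ℂ) • α - α := by
        rw [neg_sub, sub_eq_iff_eq_add] at he
        rw [he]
        abel
      rw [this]
      push_cast
      module
    rcases eq_or_eq_neg_of_smul hα hβ hβe with h | h
    · exact hβα h
    · rw [h, LinearMap.neg_apply, Complex.neg_re] at hβpos
      linarith

/-- A closed positive system consists of the roots which are positive on some coweight. -/
lemma exists_positive_coweight [FiniteDimensional ℂ H] (D : RootSystemData H) :
    ∃ (h : H) (n : Module.Dual ℂ H → ℕ), ∀ α ∈ D.Φplus, 0 < n α ∧ α h = n α := by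
  classical
  let N : H → ℕ := fun h => (D.posRoots.filter fun β => (β h).re < 0).card
  let S : Set H := {h | ∀ β ∈ D.Φ, ∃ m : ℤ, m ≠ 0 ∧ β h = m}
  obtain ⟨h, hS, hmin⟩ : ∃ h ∈ S, ∀ h' ∈ S, N h ≤ N h' := by
    obtain ⟨h, hS, hmin⟩ := (measure N).wf.has_min S (exists_regular_coweight D)
    exact ⟨h, hS, fun h' hh' => not_lt.1 (hmin h' hh')⟩
  have hsign : ∀ β ∈ D.Φ, (β h).re ≠ 0 := by
    intro β hβ
    obtain ⟨m, hm0, hm⟩ := hS β hβ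
    rw [hm]
    simpa using hm0
  suffices hpos : ∀ β ∈ D.Φplus, 0 < (β h).re by
    refine ⟨h, fun β => ⌊(β h).re⌋₊, fun β hβ => ?_⟩
    obtain ⟨m, hm0, hm⟩ := hS β (D.plus_subset hβ)
    have hp := hpos β hβ
    rw [hm, Complex.intCast_re] at hp
    have hm1 : 0 < m := by exact_mod_cast hp
    obtain ⟨k, rfl⟩ := Int.eq_ofNat_of_zero_le hm1.le
    simp only [hm]
    refine ⟨?_, ?_⟩
    · simpa using hm1
    · simp
  by_contra! hbad
  obtain ⟨β₀, hβ₀, hβ₀neg⟩ := hbad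
  obtain ⟨α, hαmem, hαmin⟩ := Finset.exists_min_image
    (D.roots.filter fun β => β ∉ D.Φplus ∧ 0 < (β h).re) (fun β => (β h).re)
    ⟨-β₀, by
      simp only [Finset.mem_filter, mem_roots]
      refine ⟨D.neg_mem _ (D.plus_subset hβ₀), neg_notMem_plus hβ₀, ?_⟩
      rw [LinearMap.neg_apply, Complex.neg_re, neg_pos]
      exact lt_of_le_of_ne hβ₀neg (hsign _ (D.plus_subset hβ₀))⟩
  simp only [Finset.mem_filter, mem_roots] at hαmem hαmin
  obtain ⟨hα, hαplus, hαpos⟩ := hαmem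
  have hind : ∀ β ∈ D.Φ, ∀ γ ∈ D.Φ, 0 < (β h).re → 0 < (γ h).re → α ≠ β + γ := by
    rintro β hβ γ hγ hβpos hγpos rfl
    rw [LinearMap.add_apply, Complex.add_re] at hαmin
    have h1 : β ∈ D.Φplus := by
      by_contra hc
      have := hαmin β ⟨hβ, hc, hβpos⟩
      linarith
    have h2 : γ ∈ D.Φplus := by
      by_contra hc
      have := hαmin γ ⟨hγ, hc, hγpos⟩
      linarith
    exact hαplus (D.plus_closed β h1 γ h2 hα)
  have heq : ∀ β : Module.Dual ℂ H, β (h - α h • coroot hα) = (β - β (coroot hα) • α) h := by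
    intro β
    simp only [map_sub, map_smul, LinearMap.sub_apply, LinearMap.smul_apply, smul_eq_mul]
    ring
  have hS' : h - α h • coroot hα ∈ S := by
    intro β hβ
    rw [heq]
    exact hS _ (sub_smul_mem hα hβ)
  have hαneg : -α ∈ D.Φplus := (mem_plus_or_neg_mem hα).resolve_left hαplus
  refine absurd (hmin _ hS') (not_le.2 (Finset.card_lt_card ?_))
  refine Finset.ssubset_iff_subset_ne.2 ⟨?_, ?_⟩
  · intro β hβ
    simp only [Finset.mem_filter, mem_posRoots] at hβ ⊢
    refine ⟨hβ.1, ?_⟩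
    by_contra hc
    have hβΦ := D.plus_subset hβ.1
    have hβpos : 0 < (β h).re := lt_of_le_of_ne (not_lt.1 hc) (hsign β hβΦ).symm
    have := reflection_pos hS hα hαpos hind hβΦ hβpos (by rintro rfl; exact hαplus hβ.1)
    rw [heq] at hβ
    linarith [hβ.2]
  · intro he
    have hmem : -α ∈ D.posRoots.filter fun β => (β h).re < 0 := by
      simp only [Finset.mem_filter, mem_posRoots]
      exact ⟨hαneg, by rw [LinearMap.neg_apply, Complex.neg_re]; linarith⟩
    rw [← he] at hmem
    have := (Finset.mem_filter.1 hmem).2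
    rw [heq, LinearMap.neg_apply, apply_coroot_self] at this
    simp at this
    linarith

end RootSystemData

namespace RootSystemData

variable {H : Type} [AddCommGroup H] [Module ℂ H] {D : RootSystemData H}

lemma BH_eq (C : D.Torus) (v : H) :
    D.BH C v = D.TTau v - ∑ α ∈ D.posRoots,
      (D.toruseval C α / (D.toruseval C α - 1) * α v) • D.TT α := by
  rw [BH, ← finsum_mem_coe_finset]
  congr 2
  ext α
  simp [mul_div_right_comm]

lemma TT_lie_TTau_sub {α : Module.Dual ℂ H} (hα : α ∈ D.Φ) (v w : H) :
    α w • ⁅D.TT α, D.TTau v⁆ - α v • ⁅D.TT α, D.TTau w⁆ =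
      ∑ β ∈ D.posRoots, (-(2⁻¹ * (α v * β w - α w * β v))) • ⁅D.TT α, D.TT β⁆ := by
  have h := TT_lie_TDelta hα (v := α w • v + (-α v) • w) (by simp; ring)
  rw [TTau_lin, lie_add, lie_smul, lie_smul, Finset.smul_sum] at h
  rw [sub_eq_add_neg, ← neg_smul, h]
  refine Finset.sum_congr rfl fun β _ => ?_
  rw [smul_smul]
  congr 1
  simp only [map_add, map_smul, smul_eq_mul]
  ring

/-- The commutator of two Bethe Hamiltonians in terms of the commutators of the `t_α`. -/
lemma BH_lie_BH (C : D.Torus) (v w : H) :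
    ⁅D.BH C v, D.BH C w⁆ = ∑ α ∈ D.posRoots, ∑ β ∈ D.posRoots,
      (D.toruseval C α / (D.toruseval C α - 1) * (D.toruseval C β / (D.toruseval C β - 1)) *
          (α v * β w) -
        2⁻¹ * (D.toruseval C α / (D.toruseval C α - 1)) * (α v * β w - α w * β v)) •
        ⁅D.TT α, D.TT β⁆ := by
  set f : Module.Dual ℂ H → ℂ := fun α => D.toruseval C α / (D.toruseval C α - 1)
  have hcross : ∑ α ∈ D.posRoots, (f α * α w) • ⁅D.TT α, D.TTau v⁆ -
      ∑ α ∈ D.posRoots, (f α * α v) • ⁅D.TT α, D.TTau w⁆ =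
      ∑ α ∈ D.posRoots, ∑ β ∈ D.posRoots,
        (-(2⁻¹ * f α * (α v * β w - α w * β v))) • ⁅D.TT α, D.TT β⁆ := by
    rw [← Finset.sum_sub_distrib]
    refine Finset.sum_congr rfl fun α hα => ?_
    rw [mul_smul, mul_smul, ← smul_sub, TT_lie_TTau_sub (D.plus_subset (mem_posRoots.1 hα)),
      Finset.smul_sum]
    refine Finset.sum_congr rfl fun β _ => ?_
    rw [smul_smul]
    congr 1
    ring
  have hquad : ⁅∑ α ∈ D.posRoots, (f α * α v) • D.TT α, ∑ β ∈ D.posRoots, (f β * β w) • D.TT β⁆ =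
      ∑ α ∈ D.posRoots, ∑ β ∈ D.posRoots, (f α * f β * (α v * β w)) • ⁅D.TT α, D.TT β⁆ := by
    rw [sum_lie_sum]
    refine Finset.sum_congr rfl fun α _ => Finset.sum_congr rfl fun β _ => ?_
    rw [smul_lie, lie_smul, smul_smul]
    congr 1
    ring
  have hlin : ∀ u u' : H, ⁅∑ α ∈ D.posRoots, (f α * α u) • D.TT α, D.TTau u'⁆ =
      ∑ α ∈ D.posRoots, (f α * α u) • ⁅D.TT α, D.TTau u'⁆ := by
    intro u u'
    rw [sum_lie]
    exact Finset.sum_congr rfl fun α _ => smul_lie _ _ _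
  rw [BH_eq, BH_eq, sub_lie, lie_sub, lie_sub, TTau_lie_TTau, ← lie_skew (D.TTau v), hlin, hlin,
    hquad]
  rw [show ∀ a b c : D.Trig, 0 - -a - (b - c) = c + (a - b) by intros; abel, hcross,
    ← Finset.sum_add_distrib]
  refine Finset.sum_congr rfl fun α _ => ?_
  rw [← Finset.sum_add_distrib]
  refine Finset.sum_congr rfl fun β _ => ?_
  rw [← add_smul, ← sub_eq_add_neg]

/-- The coefficient of a Bethe Hamiltonian in terms of `cothExp`. -/
lemma div_sub_one_eq {u : ℂ} (h : u ≠ 1) : u / (u - 1) = (1 + cothExp u) / 2 := by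
  have : u - 1 ≠ 0 := sub_ne_zero.2 h
  rw [cothExp]
  field_simp
  ring

end RootSystemData

/-- For `C ∈ T^reg`, the Bethe Hamiltonians pairwise commute in `t_Φ^trig`. -/
theorem bethe_hamiltonians_commute {H : Type} [AddCommGroup H] [Module ℂ H]
    [FiniteDimensional ℂ H] (D : RootSystemData H)
    (C : D.Torus) (hC : D.IsRegularTorus C) (h₁ h₂ : H) :
    ⁅D.BH C h₁, D.BH C h₂⁆ = 0 := by
  obtain ⟨h, n, hn⟩ := D.exists_positive_coweight
  rw [← Module.forall_dual_apply_eq_zero_iff ℂ]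
  intro φ
  have hanti : ∀ α β, φ ⁅D.TT α, D.TT β⁆ = -φ ⁅D.TT β, D.TT α⁆ := by
    intro α β
    rw [← map_neg, lie_skew]
  have key := RootSystemData.sum_cothExp_mul_eq_zero C hC
    (x := fun α β => (α h₁ * β h₂ - α h₂ * β h₁) * φ ⁅D.TT α, D.TT β⁆)
    (fun α β => by rw [hanti α β]; ring) (fun α => by ring)
    (fun C' α hα h1 => by
      have := congrArg φ (RootSystemData.sum_coth_smul_lie_eq_zero C' hα h1 h₁ h₂)
      rw [map_sum, map_zero] at this
      rw [← this]
      refine Finset.sum_congr rfl fun β _ => ?_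
      rw [map_smul, smul_eq_mul, mul_assoc]
      rfl) hn
  rw [RootSystemData.BH_lie_BH, map_sum]
  simp only [map_sum, map_smul, smul_eq_mul]
  refine add_self_eq_zero.1 ?_
  nth_rewrite 2 [Finset.sum_comm]
  rw [← Finset.sum_add_distrib, ← mul_zero (4⁻¹ : ℂ), ← key, Finset.mul_sum]
  refine Finset.sum_congr rfl fun α hα => ?_
  rw [← Finset.sum_add_distrib, Finset.mul_sum]
  refine Finset.sum_congr rfl fun β hβ => ?_
  rw [RootSystemData.div_sub_one_eq (hC α (D.plus_subset (RootSystemData.mem_posRoots.1 hα))),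
    RootSystemData.div_sub_one_eq (hC β (D.plus_subset (RootSystemData.mem_posRoots.1 hβ))),
    hanti β α]
  ring

end
end

section
/- Let c := Σ_{0≤i<j≤n} t_{ij} ∈ t_A(n+1) (a central element) and let π : t_A(n+1) → t_A(n+1)/⟨c⟩ be the quotient by the ideal generated by c. Then the composition π ∘ ψ : t_n^{trig} → t_A(n+1)/⟨c⟩ is a surjective Lie algebra homomorphism, where ψ is the homomorphism determined by ψ(t_{ij}) = t_{ij} for 1 ≤ i < j ≤ n and ψ(τ(ω_k)) = −Σ_{l=1}^{k} Σ_{c=0}^{l−1} t_{cl} for k = 1,…,n. -/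
open FreeLieAlgebra

noncomputable section

/-- The free Lie algebra on generators `t_{ij}`, `i, j ∈ {0, …, N-1}`. -/
abbrev FA (N : ℕ) := FreeLieAlgebra ℂ (Fin N × Fin N)

/-- The defining relations of the type-A holonomy Lie algebra `t_A(N)` on the index set
`{0, 1, …, N-1}`: symmetry `t_{ij} = t_{ji}` (with `t_{ii} = 0`, so that the actual
generators are `t_{ij}` for `i < j`), `[t_{ij}, t_{ik} + t_{jk}] = 0` for pairwise distinct
`i, j, k`, and `[t_{ij}, t_{kl}] = 0` for `{i,j} ∩ {k,l} = ∅`. -/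
def tARel (N : ℕ) : Set (FA N) :=
  {x | (∃ i j : Fin N, x = FreeLieAlgebra.of ℂ ((i, j) : Fin N × Fin N) -
          FreeLieAlgebra.of ℂ ((j, i) : Fin N × Fin N)) ∨
    (∃ i : Fin N, x = FreeLieAlgebra.of ℂ ((i, i) : Fin N × Fin N)) ∨
    (∃ i j k : Fin N, i ≠ j ∧ i ≠ k ∧ j ≠ k ∧
      x = ⁅FreeLieAlgebra.of ℂ ((i, j) : Fin N × Fin N),
           FreeLieAlgebra.of ℂ ((i, k) : Fin N × Fin N) +
           FreeLieAlgebra.of ℂ ((j, k) : Fin N × Fin N)⁆) ∨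
    (∃ i j k l : Fin N, i ≠ k ∧ i ≠ l ∧ j ≠ k ∧ j ≠ l ∧
      x = ⁅FreeLieAlgebra.of ℂ ((i, j) : Fin N × Fin N),
           FreeLieAlgebra.of ℂ ((k, l) : Fin N × Fin N)⁆)}

/-- The Lie ideal generated by the relations of `t_A(N)`. -/
def tAIdeal (N : ℕ) : LieIdeal ℂ (FA N) := LieSubmodule.lieSpan ℂ (FA N) (tARel N)

/-- The type-A holonomy Lie algebra `t_A(N)` (the holonomy Lie algebra of the root system
`A_{N-1}`), on the index set `{0, 1, …, N-1}`. -/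
abbrev tA (N : ℕ) := FA N ⧸ tAIdeal N

/-- The image of the generator `t_{ij}` in `t_A(N)`. -/
def tgenA (N : ℕ) (i j : Fin N) : tA N :=
  LieSubmodule.Quotient.mk' (tAIdeal N) (FreeLieAlgebra.of ℂ ((i, j) : Fin N × Fin N))

/-- `h = ℂⁿ`. -/
abbrev VA (n : ℕ) := Fin n → ℂ

/-- The coordinate functional `ε_i ∈ (ℂⁿ)*`. -/
def eps (n : ℕ) (i : Fin n) : Module.Dual ℂ (VA n) := LinearMap.proj i

/-- The type `A_{n-1}` root system `Φ = {ε_i - ε_j : i ≠ j} ⊆ (ℂⁿ)*` (gl_n realization). -/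
def PhiA (n : ℕ) : Set (Module.Dual ℂ (VA n)) :=
  {f | ∃ i j : Fin n, i ≠ j ∧ f = eps n i - eps n j}

/-- The positive roots `ε_i - ε_j`, `i < j`. -/
def PhiAplus (n : ℕ) : Set (Module.Dual ℂ (VA n)) :=
  {f | ∃ i j : Fin n, i < j ∧ f = eps n i - eps n j}

/-- The free Lie algebra on the generators `t_α` (`α ∈ Φ`) and `τ(h)` (`h ∈ ℂⁿ`). -/
abbrev FTrigA (n : ℕ) := FreeLieAlgebra ℂ (↥(PhiA n) ⊕ VA n)

open Classical in
/-- The generator `t_α` in the free Lie algebra (junk value `0` for `α ∉ Φ`). -/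
def tgA (n : ℕ) (f : Module.Dual ℂ (VA n)) : FTrigA n :=
  if h : f ∈ PhiA n then FreeLieAlgebra.of ℂ (Sum.inl (⟨f, h⟩ : ↥(PhiA n))) else 0

/-- The generator `τ(h)`. -/
def ttA (n : ℕ) (v : VA n) : FTrigA n := FreeLieAlgebra.of ℂ (Sum.inr v)

/-- `δ(h) = τ(h) - (1/2) ∑_{β ∈ Φ⁺} β(h) t_β`. -/
def tdA (n : ℕ) (v : VA n) : FTrigA n :=
  ttA n v - (2⁻¹ : ℂ) • ∑ᶠ f ∈ PhiAplus n, f v • tgA n f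

/-- The defining relations of the trigonometric holonomy Lie algebra `t_n^trig` of type
`A_{n-1}`: `t_{-α} = t_α`; `τ` is `ℂ`-linear; `[τ(h₁), τ(h₂)] = 0`;
`[t_α, ∑_{β ∈ Ψ⁺} t_β] = 0` for every closed rank-2 root subsystem `Ψ ⊆ Φ` and `α ∈ Ψ`; and
`[t_α, δ(h)] = 0` whenever `α(h) = 0`. -/
def trigARel (n : ℕ) : Set (FTrigA n) :=
  {x | (∃ α ∈ PhiA n, x = tgA n α - tgA n (-α)) ∨
    (∃ (c₁ c₂ : ℂ) (h₁ h₂ : VA n),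
      x = ttA n (c₁ • h₁ + c₂ • h₂) - c₁ • ttA n h₁ - c₂ • ttA n h₂) ∨
    (∃ h₁ h₂ : VA n, x = ⁅ttA n h₁, ttA n h₂⁆) ∨
    (∃ Ψ : Set (Module.Dual ℂ (VA n)), Ψ ⊆ PhiA n ∧ (∀ α ∈ Ψ, -α ∈ Ψ) ∧
      Module.finrank ℂ (Submodule.span ℂ Ψ) = 2 ∧
      (∀ α ∈ Ψ, ∀ β ∈ Ψ, α + β ∈ PhiA n → α + β ∈ Ψ) ∧
      ∃ α ∈ Ψ, x = ⁅tgA n α, ∑ᶠ β ∈ Ψ ∩ PhiAplus n, tgA n β⁆) ∨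
    (∃ α ∈ PhiA n, ∃ v : VA n, α v = 0 ∧ x = ⁅tgA n α, tdA n v⁆)}

/-- The Lie ideal generated by the trigonometric relations. -/
def trigAIdeal (n : ℕ) : LieIdeal ℂ (FTrigA n) :=
  LieSubmodule.lieSpan ℂ (FTrigA n) (trigARel n)

/-- The trigonometric holonomy Lie algebra `t_n^trig` of type `A_{n-1}`. -/
abbrev TrigA (n : ℕ) := FTrigA n ⧸ trigAIdeal n

/-- The image of `t_{ij} = t_{ε_i - ε_j}` in `t_n^trig`. -/
def TijA (n : ℕ) (i j : Fin n) : TrigA n :=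
  LieSubmodule.Quotient.mk' (trigAIdeal n) (tgA n (eps n i - eps n j))

/-- The image of `τ(h)` in `t_n^trig`. -/
def TauA (n : ℕ) (v : VA n) : TrigA n :=
  LieSubmodule.Quotient.mk' (trigAIdeal n) (ttA n v)

/-- `ω_k = e₁ + ⋯ + e_k ∈ ℂⁿ`. -/
def omegaA (n k : ℕ) : VA n := fun i => if (i : ℕ) < k then 1 else 0

/-- The element `∑_{l=1}^{k} ∑_{c=0}^{l-1} t_{cl} ∈ t_A(n+1)` (a partial sum of
Jucys–Murphy elements). -/
def JMsum (n k : ℕ) : tA (n + 1) :=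
  ∑ p ∈ Finset.univ.filter
      (fun p : Fin (n + 1) × Fin (n + 1) => p.1 < p.2 ∧ (p.2 : ℕ) ≤ k),
    tgenA (n + 1) p.1 p.2

/-- The central element `c = ∑_{0 ≤ i < j ≤ n} t_{ij} ∈ t_A(n+1)`. -/
def cA (n : ℕ) : tA (n + 1) :=
  ∑ p ∈ Finset.univ.filter (fun p : Fin (n + 1) × Fin (n + 1) => p.1 < p.2),
    tgenA (n + 1) p.1 p.2

/-- The symmetry `t_{ij} = t_{ji}` in `t_A(N)`. -/
theorem tgenA_symm (N : ℕ) (i j : Fin N) : tgenA N i j = tgenA N j i := by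
  rw [← sub_eq_zero, tgenA, tgenA, ← map_sub, LieSubmodule.Quotient.mk_eq_zero]
  exact LieSubmodule.subset_lieSpan (Or.inl ⟨i, j, rfl⟩)

/-- The generators with equal indices vanish in `t_A(N)`. -/
theorem tgenA_self (N : ℕ) (i : Fin N) : tgenA N i i = 0 := by
  rw [tgenA, LieSubmodule.Quotient.mk_eq_zero]
  exact LieSubmodule.subset_lieSpan (Or.inr (Or.inl ⟨i, rfl⟩))

/-- A Lie subalgebra containing the images of the free generators contains the image of every
element of a free Lie algebra. -/
theorem FreeLieAlgebra.map_mem {R X L : Type*} [CommRing R] [LieRing L] [LieAlgebra R L]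
    (f : FreeLieAlgebra R X →ₗ⁅R⁆ L) (S : LieSubalgebra R L)
    (h : ∀ x, f (FreeLieAlgebra.of R x) ∈ S) (a : FreeLieAlgebra R X) : f a ∈ S := by
  have hf : S.incl.comp (FreeLieAlgebra.lift R fun x => ⟨f (FreeLieAlgebra.of R x), h x⟩) = f :=
    FreeLieAlgebra.hom_ext fun x => by simp
  rw [← hf]
  exact (FreeLieAlgebra.lift R (fun x => (⟨f (FreeLieAlgebra.of R x), h x⟩ : S)) a).2

/-- A Lie subalgebra of `t_A(N)` containing `t_{ij}` for all `i < j` is everything. -/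
theorem mem_of_tgenA_mem {N : ℕ} (S : LieSubalgebra ℂ (tA N))
    (h : ∀ i j : Fin N, i < j → tgenA N i j ∈ S) (x : tA N) : x ∈ S := by
  obtain ⟨a, rfl⟩ := LieSubmodule.Quotient.surjective_mk' (tAIdeal N) x
  let q : FA N →ₗ⁅ℂ⁆ tA N :=
    { (LieSubmodule.Quotient.mk' (tAIdeal N) : FA N →ₗ[ℂ] tA N) with
      map_lie' := fun {x y} => LieSubmodule.Quotient.mk_bracket (I := tAIdeal N) x y }
  refine FreeLieAlgebra.map_mem q S (fun ⟨i, j⟩ => ?_) a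
  change tgenA N i j ∈ S
  rcases lt_trichotomy i j with hij | rfl | hij
  · exact h i j hij
  · rw [tgenA_self]
    exact S.zero_mem
  · rw [tgenA_symm]
    exact h j i hij

/-- A Lie subalgebra of `t_A(n+1)` containing `t_{ij}` for `1 ≤ i < j` and the partial sums of
Jucys–Murphy elements contains every `t_{0l}` with `l ≥ 1`. -/
theorem tgenA_zero_succ_mem {n : ℕ} (S : LieSubalgebra ℂ (tA (n + 1)))
    (ht : ∀ i j : Fin n, i < j → tgenA (n + 1) i.succ j.succ ∈ S)
    (hJM : ∀ k : ℕ, 1 ≤ k → k ≤ n → JMsum n k ∈ S) (l : Fin n) :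
    tgenA (n + 1) 0 l.succ ∈ S := by
  induction l using WellFoundedLT.induction with
  | ind l ih =>
    have hmem : ((0, l.succ) : Fin (n + 1) × Fin (n + 1)) ∈ Finset.univ.filter
        (fun p : Fin (n + 1) × Fin (n + 1) => p.1 < p.2 ∧ (p.2 : ℕ) ≤ l + 1) := by
      simp
    have hsum := Finset.add_sum_erase _ (fun p => tgenA (n + 1) p.1 p.2) hmem
    rw [eq_sub_of_add_eq hsum]
    refine S.sub_mem (hJM (l + 1) (by omega) l.2) (sum_mem fun p hp => ?_)
    obtain ⟨i, j⟩ := p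
    obtain ⟨hne, hp⟩ := Finset.mem_erase.mp hp
    obtain ⟨hij, hjl⟩ := (Finset.mem_filter.mp hp).2
    obtain ⟨j, rfl⟩ := Fin.exists_succ_eq.mpr (Fin.ne_zero_of_lt hij)
    rcases Fin.eq_zero_or_eq_succ i with rfl | ⟨i, rfl⟩
    · refine ih j (lt_of_le_of_ne (Fin.le_def.mpr (by simpa using hjl)) ?_)
      rintro rfl
      exact hne rfl
    · exact ht i j (Fin.succ_lt_succ_iff.mp hij)

/-- Let `π : t_A(n+1) → t_A(n+1)/⟨c⟩` be the quotient by the ideal generated by the central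
element `c = ∑_{0 ≤ i < j ≤ n} t_{ij}`. Then for the homomorphism `ψ : t_n^trig → t_A(n+1)`
determined by `ψ(t_{ij}) = t_{ij}` (`1 ≤ i < j ≤ n`) and
`ψ(τ(ω_k)) = -∑_{l=1}^{k} ∑_{c=0}^{l-1} t_{cl}` (`k = 1, …, n`), the composition `π ∘ ψ` is a
surjective Lie algebra homomorphism. -/
theorem trig_to_tA_quotient_surjective (n : ℕ) (ψ : TrigA n →ₗ⁅ℂ⁆ tA (n + 1))
    (hψt : ∀ i j : Fin n, i < j → ψ (TijA n i j) = tgenA (n + 1) i.succ j.succ)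
    (hψτ : ∀ k : ℕ, 1 ≤ k → k ≤ n → ψ (TauA n (omegaA n k)) = -JMsum n k) :
    Function.Surjective
      (fun x : TrigA n =>
        LieSubmodule.Quotient.mk'
          (LieSubmodule.lieSpan ℂ (tA (n + 1)) {cA n}) (ψ x)) := by
  refine (LieSubmodule.Quotient.surjective_mk' _).comp fun x => ?_
  have ht : ∀ i j : Fin n, i < j → tgenA (n + 1) i.succ j.succ ∈ ψ.range := fun i j hij =>
    ψ.mem_range _ |>.mpr ⟨_, hψt i j hij⟩
  have hJM : ∀ k : ℕ, 1 ≤ k → k ≤ n → JMsum n k ∈ ψ.range := fun k hk hkn =>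
    ψ.mem_range _ |>.mpr ⟨-TauA n (omegaA n k), by rw [map_neg, hψτ k hk hkn, neg_neg]⟩
  refine (ψ.mem_range x).mp (mem_of_tgenA_mem _ (fun i j hij => ?_) x)
  obtain ⟨j, rfl⟩ := Fin.exists_succ_eq.mpr (Fin.ne_zero_of_lt hij)
  rcases Fin.eq_zero_or_eq_succ i with rfl | ⟨i, rfl⟩
  · exact tgenA_zero_succ_mem ψ.range ht hJM j
  · exact ht i j (Fin.succ_lt_succ_iff.mp hij)

end
end
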